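/- Let f : Ω_κ → ℝ be a function such that |f(ω) − f(τ_ij ω)| ≤ c_ij for all ω ∈ Ω_κ, all 1 ≤ i < j ≤ N and constants c_ij ≥ 0. Then for every t ≥ 0, P_κ(f − E_κ f ≥ t) ≤ exp(− N t² / (4 Σ_{1≤i<j≤N} c_ij²)). -/

import Mathlib

open Finset Real
open scoped Classical

noncomputable section

/-- The multislice `Ω_κ ⊆ 𝒳^N`: vectors with values in `{x ℓ}` where the value `x ℓ`
appears exactly `κ ℓ` times. -/
def multislice (L N : ℕ) (κ : Fin L → ℕ) (x : Fin L → ℝ) : Finset (Fin N → ℝ) :=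
  (Fintype.piFinset fun _ : Fin N => Finset.image x Finset.univ).filter
    (fun ω => ∀ ℓ : Fin L, (Finset.univ.filter fun i => ω i = x ℓ).card = κ ℓ)

/-- Expectation with respect to the uniform distribution on a finite set. -/
def uexpect {α : Type*} (Ω : Finset α) (f : α → ℝ) : ℝ := (∑ ω ∈ Ω, f ω) / Ω.card

/-- Probability of an event with respect to the uniform distribution on a finite set. -/
def uprob {α : Type*} (Ω : Finset α) (p : α → Prop) : ℝ :=
  ((Ω.filter p).card : ℝ) / Ω.card

/-- Exponential moment bound for finitely many reals whose pairwise distances are at most `r`. -/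
theorem sum_exp_sub_mean_le {n : ℕ} (m : Fin (n + 1) → ℝ) (r : ℝ)
    (hm : ∀ k l, |m k - m l| ≤ r) :
    ∑ k, Real.exp (m k - (∑ l, m l) / (n + 1)) ≤ (n + 1) * Real.exp (r ^ 2 / 2) := by
  set μ := (∑ l, m l) / (n + 1 : ℝ) with hμ
  have hn : (0 : ℝ) < n + 1 := by positivity
  have hlow : (n + 1 : ℝ) ≤ ∑ l, Real.exp (μ - m l) := by
    have h1 : ∑ l, ((μ - m l) + 1) ≤ ∑ l, Real.exp (μ - m l) :=
      Finset.sum_le_sum fun l _ => Real.add_one_le_exp _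
    have h2 : (∑ l, m l) = (n + 1) * μ := by rw [hμ]; field_simp
    simp only [Finset.sum_add_distrib, Finset.sum_sub_distrib, Finset.sum_const, Finset.card_univ,
      Fintype.card_fin, nsmul_eq_mul, h2] at h1
    push_cast at h1
    linarith
  have hprod : (∑ l, Real.exp (μ - m l)) * ∑ k, Real.exp (m k - μ) =
      ∑ l, ∑ k, Real.exp (m k - m l) := by
    rw [Finset.sum_mul_sum]
    refine Finset.sum_congr rfl fun l _ => Finset.sum_congr rfl fun k _ => ?_
    rw [← Real.exp_add]
    congr 1
    ring
  have hsymm : ∑ l, ∑ k, Real.exp (m k - m l) = ∑ l, ∑ k, Real.cosh (m k - m l) := by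
    have h : ∑ l, ∑ k, Real.exp (m k - m l) = ∑ l, ∑ k, Real.exp (-(m k - m l)) := by
      rw [Finset.sum_comm]
      simp only [neg_sub]
    simp only [Real.cosh_eq, ← Finset.sum_div, Finset.sum_add_distrib]
    linarith
  have hcosh : ∑ l, ∑ k, Real.cosh (m k - m l) ≤
      ∑ _l : Fin (n + 1), ∑ _k : Fin (n + 1), Real.exp (r ^ 2 / 2) := by
    refine Finset.sum_le_sum fun l _ => Finset.sum_le_sum fun k _ => ?_
    refine (Real.cosh_le_exp_half_sq _).trans (Real.exp_le_exp.2 ?_)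
    have := sq_le_sq' (abs_le.1 (hm k l)).1 (abs_le.1 (hm k l)).2
    linarith
  simp only [Finset.sum_const, Finset.card_univ, Fintype.card_fin, nsmul_eq_mul] at hcosh
  push_cast at hcosh
  have hnonneg : 0 ≤ ∑ k, Real.exp (m k - μ) := Finset.sum_nonneg fun k _ => (Real.exp_pos _).le
  have h := mul_le_mul_of_nonneg_right hlow hnonneg
  rw [hprod, hsymm] at h
  exact le_of_mul_le_mul_left (h.trans hcosh) hn

/-- The permutations sending `0` to `k` are parametrized by the permutations of `Fin n`. -/
theorem sum_decomposeFin_symm {n : ℕ} (k : Fin (n + 1)) (h : Equiv.Perm (Fin (n + 1)) → ℝ) :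
    ∑ τ : Equiv.Perm (Fin n), h (Equiv.Perm.decomposeFin.symm (k, τ)) =
      ∑ ρ with ρ 0 = k, h ρ := by
  rw [Finset.sum_filter, ← Equiv.sum_comp Equiv.Perm.decomposeFin.symm, Fintype.sum_prod_type,
    Finset.sum_eq_single k]
  · simp
  · intro b _ hb
    simp [hb]
  · simp

/-- Left multiplication by a transposition permutes the values at `0`. -/
theorem sum_filter_swap_mul {n : ℕ} {a b k : Fin (n + 1)} (h : Equiv.Perm (Fin (n + 1)) → ℝ) :
    ∑ ρ with ρ 0 = k, h (Equiv.swap a b * ρ) = ∑ ρ with ρ 0 = Equiv.swap a b k, h ρ := by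
  refine Finset.sum_equiv (Equiv.mulLeft (Equiv.swap a b)) (fun ρ => ?_) fun ρ _ => rfl
  simp

/-- Given `ρ 0 = k`, the preimage of any `l ≠ k` is uniformly distributed on `{1, …, n}`. -/
theorem sum_filter_preimage {n : ℕ} {k l : Fin (n + 1)} (hkl : l ≠ k) (φ : Fin (n + 1) → ℝ)
    (hφ : φ 0 = 0) :
    n * ∑ ρ : Equiv.Perm (Fin (n + 1)) with ρ 0 = k, φ (ρ⁻¹ l) = n.factorial * ∑ j, φ j := by
  have hconst : ∀ l' ∈ Finset.univ.erase k,
      ∑ ρ : Equiv.Perm (Fin (n + 1)) with ρ 0 = k, φ (ρ⁻¹ l') =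
        ∑ ρ : Equiv.Perm (Fin (n + 1)) with ρ 0 = k, φ (ρ⁻¹ l) := by
    intro l' hl'
    have hl'k : l' ≠ k := Finset.ne_of_mem_erase hl'
    have h := sum_filter_swap_mul (a := l) (b := l') (k := k) fun ρ => φ (ρ⁻¹ l')
    rw [Equiv.swap_apply_of_ne_of_ne hkl.symm hl'k.symm] at h
    rw [← h]
    refine Finset.sum_congr rfl fun ρ _ => ?_
    simp [mul_inv_rev]
  have hcard : ∑ ρ : Equiv.Perm (Fin (n + 1)) with ρ 0 = k, (1 : ℝ) = n.factorial := by
    rw [← sum_decomposeFin_symm]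
    simp [Fintype.card_perm]
  calc n * ∑ ρ : Equiv.Perm (Fin (n + 1)) with ρ 0 = k, φ (ρ⁻¹ l)
      = ∑ l' ∈ Finset.univ.erase k,
          ∑ ρ : Equiv.Perm (Fin (n + 1)) with ρ 0 = k, φ (ρ⁻¹ l') := by
        rw [Finset.sum_congr rfl hconst, Finset.sum_const, Finset.card_erase_of_mem
          (Finset.mem_univ k), nsmul_eq_mul]
        simp
    _ = ∑ ρ : Equiv.Perm (Fin (n + 1)) with ρ 0 = k, ∑ j, φ j := by
        rw [Finset.sum_comm]
        refine Finset.sum_congr rfl fun ρ hρ => ?_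
        have hρk : ρ⁻¹ k = 0 := by
          rw [Equiv.Perm.inv_eq_iff_eq]
          exact (Finset.mem_filter.1 hρ).2.symm
        rw [← Equiv.sum_comp ρ⁻¹ φ, ← Finset.add_sum_erase _ _ (Finset.mem_univ k), hρk, hφ,
          zero_add]
    _ = n.factorial * ∑ j, φ j := by
        rw [← hcard, Finset.sum_mul]
        simp

/-- Conditioning on the value at `0` changes the mean by at most the average of `c 0 j`. -/
theorem abs_coset_mean_sub_le {n : ℕ} (g : Equiv.Perm (Fin (n + 1)) → ℝ)
    (c : Fin (n + 1) → Fin (n + 1) → ℝ) (hdiag : ∀ i, c i i = 0) (hc : ∀ i j, 0 ≤ c i j)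
    (hg : ∀ ρ i j, |g ρ - g (ρ * Equiv.swap i j)| ≤ c i j) (k l : Fin (n + 1)) :
    |(∑ τ : Equiv.Perm (Fin n), g (Equiv.Perm.decomposeFin.symm (k, τ))) / n.factorial -
      (∑ τ : Equiv.Perm (Fin n), g (Equiv.Perm.decomposeFin.symm (l, τ))) / n.factorial| ≤
        (∑ j, c 0 j) / n := by
  have hfact : (0 : ℝ) < n.factorial := by exact_mod_cast n.factorial_pos
  rcases eq_or_ne l k with rfl | hlk
  · simp only [sub_self, abs_zero]
    exact div_nonneg (Finset.sum_nonneg fun j _ => hc 0 j) (Nat.cast_nonneg n)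
  have hn : (0 : ℝ) < n := by
    rcases Nat.eq_zero_or_pos n with rfl | h
    · exact absurd (Subsingleton.elim (α := Fin 1) l k) hlk
    · exact_mod_cast h
  rw [← sub_div, abs_div, abs_of_pos hfact, div_le_div_iff₀ hfact hn, mul_comm _ (n : ℝ),
    mul_comm _ (n.factorial : ℝ), ← sum_filter_preimage hlk (c 0) (hdiag 0)]
  refine mul_le_mul_of_nonneg_left ?_ hn.le
  have hl := sum_filter_swap_mul (a := k) (b := l) (k := k) g
  rw [Equiv.swap_apply_left] at hl
  rw [sum_decomposeFin_symm, sum_decomposeFin_symm, ← hl, ← Finset.sum_sub_distrib]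
  refine (Finset.abs_sum_le_sum_abs _ _).trans (Finset.sum_le_sum fun ρ hρ => ?_)
  have hρ0 : ρ 0 = k := (Finset.mem_filter.1 hρ).2
  have h := hg ρ 0 (ρ⁻¹ l)
  have hinv : ρ (ρ⁻¹ l) = l := ρ.apply_symm_apply l
  rwa [Equiv.mul_swap_eq_swap_mul, hρ0, hinv] at h

theorem decomposeFin_symm_mul_swap {n : ℕ} (k : Fin (n + 1)) (τ : Equiv.Perm (Fin n))
    (i j : Fin n) :
    Equiv.Perm.decomposeFin.symm (k, τ * Equiv.swap i j) =
      Equiv.Perm.decomposeFin.symm (k, τ) * Equiv.swap i.succ j.succ := by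
  ext x
  refine Fin.cases ?_ (fun y => ?_) x
  · rw [Equiv.Perm.mul_apply, Equiv.swap_apply_of_ne_of_ne (Fin.succ_ne_zero i).symm
      (Fin.succ_ne_zero j).symm]
    simp
  · rw [Equiv.Perm.mul_apply, ← (Fin.succ_injective n).map_swap]
    simp

/-- Exponential moment bound for functions on the symmetric group with bounded differences along
transpositions. -/
theorem sum_perm_exp_sub_mean_le (n : ℕ) (g : Equiv.Perm (Fin n) → ℝ)
    (c : Fin n → Fin n → ℝ) (hsymm : ∀ i j, c i j = c j i) (hdiag : ∀ i, c i i = 0)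
    (hg : ∀ ρ i j, |g ρ - g (ρ * Equiv.swap i j)| ≤ c i j) :
    ∑ ρ, Real.exp (g ρ - (∑ ρ, g ρ) / n.factorial) ≤
      n.factorial * Real.exp ((∑ i, ∑ j, c i j ^ 2) / (2 * n)) := by
  induction n with
  | zero => simp
  | succ n ih =>
    have hc : ∀ i j, 0 ≤ c i j := fun i j => (abs_nonneg _).trans (hg 1 i j)
    wlog hmax : ∀ i, ∑ j, c i j ^ 2 ≤ ∑ j, c 0 j ^ 2 generalizing g c
    · obtain ⟨i₀, -, hi₀⟩ := Finset.exists_max_image Finset.univ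
        (fun i : Fin (n + 1) => ∑ j, c i j ^ 2) Finset.univ_nonempty
      set s := Equiv.swap 0 i₀ with hs
      have h := this (fun ρ => g (ρ * s)) (fun a b => c (s a) (s b))
        (fun i j => hsymm _ _) (fun i => hdiag _)
        (fun ρ i j => by
          have h := hg (ρ * s) (s i) (s j)
          have hconj : ρ * s * Equiv.swap (s i) (s j) = ρ * Equiv.swap i j * s := by
            have hinv : ∀ a, s (s a) = a := Equiv.swap_apply_self 0 i₀
            rw [mul_assoc, Equiv.mul_swap_eq_swap_mul s, hinv, hinv, mul_assoc]
          rwa [hconj] at h) (fun i j => hc _ _)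
        (fun i => by
          rw [Equiv.sum_comp s fun j => c (s i) j ^ 2, Equiv.sum_comp s fun j => c (s 0) j ^ 2,
            hs, Equiv.swap_apply_left]
          exact hi₀ _ (Finset.mem_univ _))
      have e1 : ∑ ρ, g (ρ * s) = ∑ ρ, g ρ := Equiv.sum_comp (Equiv.mulRight s) g
      have e2 : ∑ i, ∑ j, c (s i) (s j) ^ 2 = ∑ i, ∑ j, c i j ^ 2 := by
        rw [Equiv.sum_comp s fun i => ∑ j, c i (s j) ^ 2]
        exact Finset.sum_congr rfl fun i _ => Equiv.sum_comp s fun j => c i j ^ 2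
      rw [e1, e2] at h
      rwa [← Equiv.sum_comp (Equiv.mulRight s)]
    set m : Fin (n + 1) → ℝ := fun k =>
      (∑ τ : Equiv.Perm (Fin n), g (Equiv.Perm.decomposeFin.symm (k, τ))) / n.factorial with hm
    have hfact : (0 : ℝ) < n.factorial := by exact_mod_cast n.factorial_pos
    have hmean : (∑ ρ, g ρ) / (n + 1).factorial = (∑ k, m k) / (n + 1) := by
      rw [← Equiv.sum_comp Equiv.Perm.decomposeFin.symm, Fintype.sum_prod_type, hm,
        ← Finset.sum_div, Nat.factorial_succ]
      push_cast
      rw [div_div, mul_comm]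
    set S' := ∑ i : Fin n, ∑ j : Fin n, c i.succ j.succ ^ 2 with hS'
    have hinner : ∀ k, ∑ τ : Equiv.Perm (Fin n),
        Real.exp (g (Equiv.Perm.decomposeFin.symm (k, τ)) - m k) ≤
          n.factorial * Real.exp (S' / (2 * n)) := fun k =>
      ih (fun τ => g (Equiv.Perm.decomposeFin.symm (k, τ))) (fun i j => c i.succ j.succ)
        (fun i j => hsymm _ _) (fun i => hdiag _) fun τ i j => by
          simpa only [decomposeFin_symm_mul_swap] using hg _ i.succ j.succ
    have houter := sum_exp_sub_mean_le m _ (abs_coset_mean_sub_le g c hdiag hc hg)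
    have hS : ∑ i, ∑ j, c i j ^ 2 = 2 * (∑ j, c 0 j ^ 2) + S' := by
      simp only [Fin.sum_univ_succ, hdiag, Finset.sum_add_distrib, hS', hsymm (Fin.succ _) 0]
      ring
    have hSR : ∑ i, ∑ j, c i j ^ 2 ≤ (n + 1) * ∑ j, c 0 j ^ 2 := by
      have h := Finset.sum_le_sum fun i (_ : i ∈ Finset.univ) => hmax i
      simpa using h
    have hR0 : 0 ≤ ∑ j, c 0 j ^ 2 := Finset.sum_nonneg fun j _ => sq_nonneg _
    have hS'0 : 0 ≤ S' := Finset.sum_nonneg fun i _ => Finset.sum_nonneg fun j _ => sq_nonneg _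
    have hexp : ((∑ j, c 0 j) / n) ^ 2 / 2 + S' / (2 * n) ≤
        (∑ i, ∑ j, c i j ^ 2) / (2 * (n + 1 : ℕ)) := by
      rcases Nat.eq_zero_or_pos n with rfl | hpos
      · simp only [CharP.cast_eq_zero, div_zero, mul_zero]
        rw [hS]
        norm_num
        positivity
      have hn : (0 : ℝ) < n := by exact_mod_cast hpos
      have hcs : (∑ j, c 0 j) ^ 2 ≤ n * ∑ j, c 0 j ^ 2 := by
        have h := sq_sum_le_card_mul_sum_sq (s := Finset.univ) (f := fun j : Fin n => c 0 j.succ)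
        simpa [Fin.sum_univ_succ, hdiag] using h
      have h1 : ((∑ j, c 0 j) / n) ^ 2 ≤ (∑ j, c 0 j ^ 2) / n := by
        rw [div_pow, div_le_div_iff₀ (by positivity) hn]
        nlinarith
      have h2 : ((∑ j, c 0 j ^ 2) + S') / (2 * n) ≤
          (∑ i, ∑ j, c i j ^ 2) / (2 * (n + 1 : ℕ)) := by
        push_cast
        rw [div_le_div_iff₀ (by positivity) (by positivity)]
        nlinarith
      have h3 : ((∑ j, c 0 j ^ 2) + S') / (2 * n) =
          (∑ j, c 0 j ^ 2) / n / 2 + S' / (2 * n) := by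
        field_simp
      linarith
    calc ∑ ρ, Real.exp (g ρ - (∑ ρ, g ρ) / (n + 1).factorial)
        = ∑ k, Real.exp (m k - (∑ l, m l) / (n + 1)) * ∑ τ : Equiv.Perm (Fin n),
            Real.exp (g (Equiv.Perm.decomposeFin.symm (k, τ)) - m k) := by
          rw [hmean, ← Equiv.sum_comp Equiv.Perm.decomposeFin.symm, Fintype.sum_prod_type]
          refine Finset.sum_congr rfl fun k _ => ?_
          rw [Finset.mul_sum]
          refine Finset.sum_congr rfl fun τ _ => ?_
          rw [← Real.exp_add]
          congr 1
          ring
      _ ≤ ∑ k, Real.exp (m k - (∑ l, m l) / (n + 1)) *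
            (n.factorial * Real.exp (S' / (2 * n))) :=
          Finset.sum_le_sum fun k _ => mul_le_mul_of_nonneg_left (hinner k) (Real.exp_pos _).le
      _ ≤ ((n + 1) * Real.exp (((∑ j, c 0 j) / n) ^ 2 / 2)) *
            (n.factorial * Real.exp (S' / (2 * n))) := by
          rw [← Finset.sum_mul]
          exact mul_le_mul_of_nonneg_right houter (by positivity)
      _ = (n + 1).factorial * Real.exp (((∑ j, c 0 j) / n) ^ 2 / 2 + S' / (2 * n)) := by
          rw [Real.exp_add, Nat.factorial_succ]
          push_cast
          ring
      _ ≤ _ := mul_le_mul_of_nonneg_left (Real.exp_le_exp.2 hexp) (Nat.cast_nonneg _)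

theorem comp_perm_mem_multislice {L N : ℕ} {κ : Fin L → ℕ} {x : Fin L → ℝ} {ω : Fin N → ℝ}
    (hω : ω ∈ multislice L N κ x) (σ : Equiv.Perm (Fin N)) :
    ω ∘ σ ∈ multislice L N κ x := by
  simp only [multislice, Finset.mem_filter, Fintype.mem_piFinset] at hω ⊢
  refine ⟨fun i => hω.1 _, fun ℓ => ?_⟩
  rw [← hω.2 ℓ]
  exact Finset.card_equiv σ (by simp)

/-- The symmetric group acts transitively on the multislice. -/
theorem exists_perm_of_mem_multislice {L N : ℕ} {κ : Fin L → ℕ} {x : Fin L → ℝ}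
    {ω η : Fin N → ℝ} (hω : ω ∈ multislice L N κ x) (hη : η ∈ multislice L N κ x) :
    ∃ σ : Equiv.Perm (Fin N), ω ∘ σ = η := by
  simp only [multislice, Finset.mem_filter, Fintype.mem_piFinset] at hω hη
  have hcard : ∀ a : ℝ, Nonempty ({i // η i = a} ≃ {i // ω i = a}) := by
    intro a
    rw [← Fintype.card_eq, Fintype.card_subtype, Fintype.card_subtype]
    by_cases ha : ∃ ℓ, a = x ℓ
    · obtain ⟨ℓ, rfl⟩ := ha
      rw [hω.2, hη.2]
    · have hempty : ∀ ξ : Fin N → ℝ, (∀ i, ξ i ∈ Finset.image x Finset.univ) →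
          (Finset.univ.filter fun i => ξ i = a) = ∅ := by
        intro ξ hξ
        refine Finset.filter_eq_empty_iff.2 fun i _ hi => ha ?_
        obtain ⟨ℓ, -, hℓ⟩ := Finset.mem_image.1 (hξ i)
        exact ⟨ℓ, by rw [hℓ, hi]⟩
      rw [hempty _ hω.1, hempty _ hη.1]
  exact ⟨Equiv.ofFiberEquiv fun a => (hcard a).some,
    funext fun i => Equiv.ofFiberEquiv_map (g := ω) _ i⟩

/-- A uniform permutation of a point of the multislice is uniform on the multislice. -/
theorem sum_perm_eq_sum_multislice {L N : ℕ} {κ : Fin L → ℕ} {x : Fin L → ℝ} {ω : Fin N → ℝ}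
    (hω : ω ∈ multislice L N κ x) :
    ∃ C : ℝ, 0 < C ∧ ∀ h : (Fin N → ℝ) → ℝ,
      ∑ σ : Equiv.Perm (Fin N), h (ω ∘ σ) = C * ∑ η ∈ multislice L N κ x, h η := by
  refine ⟨((Finset.univ.filter fun σ : Equiv.Perm (Fin N) => ω ∘ σ = ω).card : ℝ), ?_, ?_⟩
  · exact_mod_cast Finset.card_pos.2 ⟨1, by simp⟩
  · intro h
    rw [← Finset.sum_fiberwise_of_maps_to (t := multislice L N κ x)
      (g := fun σ : Equiv.Perm (Fin N) => ω ∘ σ)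
      (fun σ _ => comp_perm_mem_multislice hω σ), Finset.mul_sum]
    refine Finset.sum_congr rfl fun η hη => ?_
    rw [Finset.sum_congr rfl (g := fun _ => h η)
      (fun σ hσ => by rw [(Finset.mem_filter.1 hσ).2]), Finset.sum_const, nsmul_eq_mul]
    congr 2
    obtain ⟨ρ, rfl⟩ := exists_perm_of_mem_multislice hω hη
    refine Finset.card_equiv (Equiv.mulRight ρ⁻¹) fun σ => ?_
    simp only [Finset.mem_filter, Finset.mem_univ, true_and, Equiv.coe_mulRight,
      Equiv.Perm.coe_mul, ← Function.comp_assoc]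
    constructor
    · intro e
      rw [e, Function.comp_assoc, ← Equiv.Perm.coe_mul, mul_inv_cancel]
      rfl
    · intro e
      calc (ω ∘ σ) = ((ω ∘ σ) ∘ ⇑ρ⁻¹) ∘ ρ := by
            rw [Function.comp_assoc, ← Equiv.Perm.coe_mul, inv_mul_cancel]
            rfl
        _ = ω ∘ ρ := by rw [e]

/-- The symmetric extension of `c` from ordered pairs `i < j`, vanishing on the diagonal. -/
def symmExtension {N : ℕ} (c : Fin N → Fin N → ℝ) (i j : Fin N) : ℝ :=
  if i < j then c i j else if j < i then c j i else 0

theorem symmExtension_comm {N : ℕ} (c : Fin N → Fin N → ℝ) (i j : Fin N) :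
    symmExtension c i j = symmExtension c j i := by
  unfold symmExtension
  rcases lt_trichotomy i j with h | h | h
  · simp [h, h.not_gt]
  · simp [h]
  · simp [h, h.not_gt]

theorem symmExtension_self {N : ℕ} (c : Fin N → Fin N → ℝ) (i : Fin N) :
    symmExtension c i i = 0 := by
  simp [symmExtension]

theorem sum_symmExtension_sq {N : ℕ} (c : Fin N → Fin N → ℝ) :
    ∑ i, ∑ j, symmExtension c i j ^ 2 =
      2 * ∑ q ∈ (Finset.univ : Finset (Fin N × Fin N)).filter fun q => q.1 < q.2,
        c q.1 q.2 ^ 2 := by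
  have hsplit : ∀ i j, symmExtension c i j ^ 2 =
      (if i < j then c i j ^ 2 else 0) + if j < i then c j i ^ 2 else 0 := by
    intro i j
    unfold symmExtension
    rcases lt_trichotomy i j with h | h | h
    · simp [h, h.not_gt]
    · simp [h]
    · simp [h, h.not_gt]
  simp only [hsplit, Finset.sum_add_distrib]
  rw [Finset.sum_comm (f := fun i j => if j < i then c j i ^ 2 else 0), Finset.sum_filter,
    Fintype.sum_prod_type]
  ring

/-- Exponential moment bound on the multislice. -/
theorem sum_multislice_exp_le {L N : ℕ} {κ : Fin L → ℕ} {x : Fin L → ℝ}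
    (hne : (multislice L N κ x).Nonempty) (f : (Fin N → ℝ) → ℝ) (c : Fin N → Fin N → ℝ)
    (hf : ∀ ω ∈ multislice L N κ x, ∀ i j : Fin N, i < j →
      |f ω - f (ω ∘ Equiv.swap i j)| ≤ c i j) (s : ℝ) (hs : 0 ≤ s) :
    ∑ ω ∈ multislice L N κ x, Real.exp (s * (f ω - uexpect (multislice L N κ x) f)) ≤
      (multislice L N κ x).card * Real.exp (s ^ 2 *
        (∑ q ∈ (Finset.univ : Finset (Fin N × Fin N)).filter fun q => q.1 < q.2,
          c q.1 q.2 ^ 2) / N) := by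
  obtain ⟨ω, hω⟩ := hne
  obtain ⟨C, hC, hsum⟩ := sum_perm_eq_sum_multislice hω
  have hcard : (N.factorial : ℝ) = C * (multislice L N κ x).card := by
    have h := hsum fun _ => 1
    simpa [Fintype.card_perm] using h
  have hg : ∀ (ρ : Equiv.Perm (Fin N)) (i j : Fin N),
      |s * f (ω ∘ ρ) - s * f (ω ∘ ⇑(ρ * Equiv.swap i j))| ≤ s * symmExtension c i j := by
    intro ρ i j
    rw [← mul_sub, abs_mul, abs_of_nonneg hs, Equiv.Perm.coe_mul, ← Function.comp_assoc]
    refine mul_le_mul_of_nonneg_left ?_ hs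
    have hmem := comp_perm_mem_multislice hω ρ
    unfold symmExtension
    rcases lt_trichotomy i j with h | h | h
    · simpa [h] using hf _ hmem i j h
    · simp [h, Equiv.swap_self]
    · simpa [h, h.not_gt, Equiv.swap_comm i j] using hf _ hmem j i h
  have h := sum_perm_exp_sub_mean_le N (fun ρ => s * f (ω ∘ ρ))
    (fun i j => s * symmExtension c i j) (fun i j => by rw [symmExtension_comm])
    (fun i => by rw [symmExtension_self, mul_zero]) hg
  have hmean : (∑ ρ : Equiv.Perm (Fin N), s * f (ω ∘ ρ)) / N.factorial =
      s * uexpect (multislice L N κ x) f := by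
    rw [hsum fun η => s * f η, hcard, mul_div_mul_left _ _ hC.ne', ← Finset.mul_sum, uexpect,
      mul_div_assoc]
  simp only [mul_pow, ← Finset.mul_sum, sum_symmExtension_sq] at h
  simp only [Finset.mul_sum] at h hmean
  rw [hmean, hsum fun η => Real.exp (s * f η - s * uexpect (multislice L N κ x) f), hcard,
    mul_assoc] at h
  have h' := le_of_mul_le_mul_left h hC
  simp only [← mul_sub, ← Finset.mul_sum] at h'
  rwa [mul_left_comm, mul_div_mul_left _ _ two_ne_zero] at h'

theorem uprob_le_one {α : Type*} (Ω : Finset α) (p : α → Prop) : uprob Ω p ≤ 1 :=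
  div_le_one_of_le₀ (by exact_mod_cast Finset.card_filter_le _ _) (Nat.cast_nonneg _)

/-- Chernoff's bound for the uniform distribution on a finite set. -/
theorem uprob_le_of_sum_exp_le {α : Type*} {Ω : Finset α} (hΩ : Ω.Nonempty) (g : α → ℝ)
    {s t b : ℝ} (hs : 0 ≤ s)
    (h : ∑ ω ∈ Ω, Real.exp (s * g ω) ≤ Ω.card * Real.exp b) :
    uprob Ω (fun ω => g ω ≥ t) ≤ Real.exp (b - s * t) := by
  have hcard : (0 : ℝ) < Ω.card := by exact_mod_cast hΩ.card_pos
  have hmarkov : (Ω.filter fun ω => g ω ≥ t).card * Real.exp (s * t) ≤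
      ∑ ω ∈ Ω, Real.exp (s * g ω) := by
    rw [← nsmul_eq_mul, ← Finset.sum_const]
    refine (Finset.sum_le_sum fun ω hω => ?_).trans
      (Finset.sum_le_sum_of_subset_of_nonneg (Finset.filter_subset _ _)
        fun ω _ _ => (Real.exp_pos _).le)
    exact Real.exp_le_exp.2 (mul_le_mul_of_nonneg_left (Finset.mem_filter.1 hω).2 hs)
  rw [uprob, div_le_iff₀ hcard, Real.exp_sub, div_mul_eq_mul_div, le_div_iff₀ (Real.exp_pos _)]
  linarith

/-- Bounded differences inequality on the multislice. -/
theorem stmt0 (L N : ℕ) (hL : 2 ≤ L) (κ : Fin L → ℕ) (hκ : ∀ ℓ, 1 ≤ κ ℓ)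
    (hN : N = ∑ ℓ, κ ℓ) (x : Fin L → ℝ) (hx : StrictMono x)
    (f : (Fin N → ℝ) → ℝ) (c : Fin N → Fin N → ℝ)
    (hc : ∀ i j : Fin N, 0 ≤ c i j)
    (hf : ∀ ω ∈ multislice L N κ x, ∀ i j : Fin N, i < j →
      |f ω - f (ω ∘ Equiv.swap i j)| ≤ c i j)
    (t : ℝ) (ht : 0 ≤ t) :
    uprob (multislice L N κ x) (fun ω => f ω - uexpect (multislice L N κ x) f ≥ t) ≤
      Real.exp (-(N * t ^ 2) /
        (4 * ∑ q ∈ (Finset.univ : Finset (Fin N × Fin N)).filter fun q => q.1 < q.2,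
          c q.1 q.2 ^ 2)) := by
  rcases (multislice L N κ x).eq_empty_or_nonempty with hempty | hne
  · rw [hempty]
    simp [uprob, Real.exp_nonneg]
  set P := ∑ q ∈ (Finset.univ : Finset (Fin N × Fin N)).filter fun q => q.1 < q.2,
    c q.1 q.2 ^ 2 with hP
  have hP0 : 0 ≤ P := Finset.sum_nonneg fun q _ => sq_nonneg _
  rcases hP0.eq_or_lt with hzero | hpos
  · rw [← hzero, mul_zero, div_zero, Real.exp_zero]
    exact uprob_le_one _ _
  rcases Nat.eq_zero_or_pos N with hN0 | hNpos
  · have : (N : ℝ) = 0 := by exact_mod_cast hN0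
    rw [this, zero_mul, neg_zero, zero_div, Real.exp_zero]
    exact uprob_le_one _ _
  have hNpos' : (0 : ℝ) < N := by exact_mod_cast hNpos
  have hs : 0 ≤ t * N / (2 * P) := by positivity
  refine (uprob_le_of_sum_exp_le hne _ hs (sum_multislice_exp_le hne f c hf _ hs)).trans_eq ?_
  rw [← hP]
  congr 1
  field_simp
  ring
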